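/- arXiv:1609.00773 — 3 statements merged into one kernel-verified Lean document; each statement's English description precedes it below -/
import Mathlib

section
/- Let (V, σ) be a symplectic vector space with dim V = 2n, let e₁, …, eₙ, f₁, …, fₙ be a symplectic basis of (V, σ), and let x₁, y₁, …, xₙ, yₙ be the dual basis of V*. Then for any subsets I, J ⊆ {1, …, n}, there exist a real constant c and subsets I', J' ⊆ {1, …, n} such that ⋆(x_I ∧ y_J) = c · x_{I'} ∧ y_{J'}, where x_I = x_{i₁} ∧ ⋯ ∧ x_{i_p} for I = {i₁ < ⋯ < i_p} and similarly for y_J: the symplectic Hodge star of a coordinate monomial is a scalar multiple of a single coordinate monomial. -/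
open ExteriorAlgebra Module

set_option synthInstance.maxHeartbeats 1000000
set_option maxHeartbeats 1000000

noncomputable section

variable {V : Type*} [AddCommGroup V] [Module ℝ V] [FiniteDimensional ℝ V]

/-- The canonical image of an alternating bilinear form `σ` on `V` as an element of
`⋀² V*` inside the exterior algebra of the dual space. -/
def sigmaForm (σ : LinearMap.BilinForm ℝ V) : ExteriorAlgebra ℝ (Module.Dual ℝ V) :=
  (2 : ℝ)⁻¹ • ∑ i, ∑ j, σ (Module.finBasis ℝ V i) (Module.finBasis ℝ V j) •
    (ExteriorAlgebra.ι ℝ ((Module.finBasis ℝ V).coord i) *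
      ExteriorAlgebra.ι ℝ ((Module.finBasis ℝ V).coord j))

/-- Contraction of forms (elements of the exterior algebra of `V*`) by a vector `X ∈ V`. -/
def contr (X : V) :
    ExteriorAlgebra ℝ (Module.Dual ℝ V) →ₗ[ℝ] ExteriorAlgebra ℝ (Module.Dual ℝ V) :=
  CliffordAlgebra.contractLeft (Q := (0 : QuadraticForm ℝ (Module.Dual ℝ V)))
    (Module.Dual.eval ℝ V X)

/-- The insertion operators, assembled into an algebra morphism from `⋀ V` to (opposite)
endomorphisms of `⋀ V*`. -/
def insertionOp :
    ExteriorAlgebra ℝ V →ₐ[ℝ]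
      (Module.End ℝ (ExteriorAlgebra ℝ (Module.Dual ℝ V)))ᵐᵒᵖ :=
  ExteriorAlgebra.lift ℝ
    ⟨{ toFun := fun X => MulOpposite.op (contr X)
       map_add' := fun X Y => by
         apply MulOpposite.unop_injective
         refine LinearMap.ext fun ω => ?_
         show contr (X + Y) ω = (contr X + contr Y) ω
         simp [contr]
       map_smul' := fun c X => by
         apply MulOpposite.unop_injective
         refine LinearMap.ext fun ω => ?_
         show contr (c • X) ω = (c • contr X) ω
         simp [contr] },
     fun X => by
       apply MulOpposite.unop_injective
       refine LinearMap.ext fun ω => ?_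
       show contr X (contr X ω) = 0
       exact CliffordAlgebra.contractLeft_contractLeft _ _⟩

/-- The natural duality pairing between `⋀^k V` and `⋀^k V*` (extended by zero between
components of different degrees): on decomposables it is
`⟨v₁ ∧ ⋯ ∧ v_k, f₁ ∧ ⋯ ∧ f_k⟩ = det (fᵢ (vⱼ))`. -/
def dualPairing (x : ExteriorAlgebra ℝ V) (ω : ExteriorAlgebra ℝ (Module.Dual ℝ V)) : ℝ :=
  ExteriorAlgebra.algebraMapInv ((insertionOp (V := V) x).unop ω)

/-- The extension `♯ : ⋀ V* → ⋀ V` of the inverse of the isomorphism `X ↦ ι_X σ`. -/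
def sharpMap (σ : LinearMap.BilinForm ℝ V) (hσ : σ.Nondegenerate) :
    ExteriorAlgebra ℝ (Module.Dual ℝ V) →ₐ[ℝ] ExteriorAlgebra ℝ V :=
  ExteriorAlgebra.map (σ.toDual hσ).symm.toLinearMap

/-- The pairing `B(α, β) = ⟨♯α, β⟩` on the exterior algebra of `V*`. -/
def Bpair (σ : LinearMap.BilinForm ℝ V) (hσ : σ.Nondegenerate)
    (α β : ExteriorAlgebra ℝ (Module.Dual ℝ V)) : ℝ :=
  dualPairing (sharpMap σ hσ α) β

/-- The predicate stating that `star` is the symplectic Hodge star operator: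
for `α ∈ ⋀^k V*` (`0 ≤ k ≤ 2n`), `star α` is the element of `⋀^(2n-k) V*` such that
`β ∧ star α = B(β, α) • σⁿ/n!` for all `β ∈ ⋀^k V*`. -/
def IsHodgeStar (σ : LinearMap.BilinForm ℝ V) (hσ : σ.Nondegenerate) (n : ℕ)
    (star : ExteriorAlgebra ℝ (Module.Dual ℝ V) → ExteriorAlgebra ℝ (Module.Dual ℝ V)) :
    Prop :=
  ∀ k : ℕ, k ≤ 2 * n → ∀ α ∈ ⋀[ℝ]^k (Module.Dual ℝ V),
    star α ∈ ⋀[ℝ]^(2 * n - k) (Module.Dual ℝ V) ∧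
      ∀ β ∈ ⋀[ℝ]^k (Module.Dual ℝ V),
        β * star α = Bpair σ hσ β α • ((n.factorial : ℝ)⁻¹ • (sigmaForm σ) ^ n)

/-- The wedge monomial `f_{i₁} ∧ ⋯ ∧ f_{i_p}` associated to a family `f` and a finite index set
`I = {i₁ < ⋯ < i_p}`. -/
def coordWedge {n : ℕ} (f : Fin n → Module.Dual ℝ V) (I : Finset (Fin n)) :
    ExteriorAlgebra ℝ (Module.Dual ℝ V) :=
  ((I.sort (· ≤ ·)).map fun i => ExteriorAlgebra.ι ℝ (f i)).prod

/-- The standard basis of the exterior algebra consists of sorted wedge products. -/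
theorem ExteriorAlgebra.basis_eq_prod_sort {R M I : Type*} [CommRing R] [AddCommGroup M]
    [Module R M] [LinearOrder I] (b : Basis I R M) (s : Finset I) :
    b.ExteriorAlgebra s = ((s.sort (· ≤ ·)).map fun i => ExteriorAlgebra.ι R (b i)).prod := by
  rw [ExteriorAlgebra.basis_apply_ofCard b rfl, ExteriorAlgebra.ιMulti_family,
    ExteriorAlgebra.ιMulti_apply, ← Finset.listMap_orderEmbOfFin_finRange s rfl, List.map_map,
    List.ofFn_eq_map]
  rfl

/-- A homogeneous element annihilated by all basis monomials of complementary degree other than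
`E u` is a multiple of the complementary monomial `E uᶜ`. -/
theorem ExteriorAlgebra.eq_smul_basis_compl_of_basis_mul_eq_zero {K M I : Type*} [Field K]
    [AddCommGroup M] [Module K M] [LinearOrder I] [Fintype I] (b : Basis I K M) {m : ℕ}
    {ω : ExteriorAlgebra K M} (hω : ω ∈ ⋀[K]^m M) {u : Finset I}
    (hu : u.card + m = Fintype.card I)
    (h : ∀ s : Finset I, s.card = u.card → s ≠ u → b.ExteriorAlgebra s * ω = 0) :
    ∃ c : K, ω = c • b.ExteriorAlgebra uᶜ := by
  let B := b.exteriorPower m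
  have hsum : ω = ∑ t : Set.powersetCard I m, B.repr ⟨ω, hω⟩ t • b.ExteriorAlgebra t := by
    have := congrArg Subtype.val (B.sum_repr ⟨ω, hω⟩)
    simpa [ExteriorAlgebra.basis_eq_coe_basis, B] using this.symm
  have hcoeff : ∀ t : Set.powersetCard I m, (t : Finset I) ≠ uᶜ → B.repr ⟨ω, hω⟩ t = 0 := by
    intro t ht
    have htc : (t : Finset I)ᶜ.card = u.card := by
      have := Set.powersetCard.card_eq t
      rw [Finset.card_compl]
      omega
    have h0 := h (t : Finset I)ᶜ htc fun hc => ht (by rw [← hc, compl_compl])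
    let s : Set.powersetCard I u.card := Set.powersetCard.ofCard htc
    have hdisj : Disjoint s.val t.val := disjoint_compl_left
    rw [hsum, Finset.mul_sum, Finset.sum_eq_single t] at h0
    · rw [mul_smul_comm] at h0
      refine (smul_eq_zero.mp h0).resolve_right fun hz => ?_
      have hmul := ExteriorAlgebra.basis_mul_of_disjoint b s t hdisj
      rw [show b.ExteriorAlgebra s * b.ExteriorAlgebra t = 0 from hz] at hmul
      exact b.ExteriorAlgebra.ne_zero _ ((smul_eq_zero_iff_eq _).mp hmul.symm)
    · intro t' _ hne
      have hnd : ¬ Disjoint s.val t'.val := fun hd => hne <| by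
        rw [Set.powersetCard.eq_iff_subset]
        exact disjoint_compl_left_iff.mp hd
      rw [mul_smul_comm]
      have hmul := ExteriorAlgebra.basis_mul_of_not_disjoint b s t' hnd
      rw [show b.ExteriorAlgebra (t : Finset I)ᶜ * b.ExteriorAlgebra t' = 0 from hmul, smul_zero]
    · simp
  let t₀ : Set.powersetCard I m := ⟨uᶜ, by
    rw [Set.powersetCard.mem_iff, Finset.card_compl]
    omega⟩
  refine ⟨B.repr ⟨ω, hω⟩ t₀, ?_⟩
  conv_lhs => rw [hsum]
  refine Finset.sum_eq_single t₀ (fun t _ ht => ?_) (by simp)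
  rw [hcoeff t fun hc => ht (Subtype.ext hc), zero_smul]

omit [FiniteDimensional ℝ V] in
theorem contr_prod_ι_eq_zero {X : V} {l : List (Module.Dual ℝ V)} (h : ∀ f ∈ l, f X = 0) :
    contr X ((l.map (ExteriorAlgebra.ι ℝ)).prod) = 0 := by
  induction l with
  | nil => exact CliffordAlgebra.contractLeft_one _ _
  | cons f l ih =>
    rw [List.map_cons, List.prod_cons]
    refine (CliffordAlgebra.contractLeft_ι_mul _ _ _).trans ?_
    have ih' := ih fun g hg => h g (List.mem_cons_of_mem _ hg)
    rw [contr] at ih'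
    rw [ih', mul_zero, sub_zero, Module.Dual.eval_apply, h f List.mem_cons_self, zero_smul]

omit [FiniteDimensional ℝ V] in
theorem insertionOp_prod_ι_eq_zero {X : V} {l : List V} (hX : X ∈ l)
    {ω : ExteriorAlgebra ℝ (Module.Dual ℝ V)} (hω : contr X ω = 0) :
    (insertionOp ((l.map (ExteriorAlgebra.ι ℝ)).prod)).unop ω = 0 := by
  have hι (Y : V) : insertionOp (ExteriorAlgebra.ι ℝ Y) = MulOpposite.op (contr Y) :=
    ExteriorAlgebra.lift_ι_apply ..
  induction l generalizing ω with
  | nil => simp at hX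
  | cons Y l ih =>
    rw [List.map_cons, List.prod_cons, map_mul, MulOpposite.unop_mul, Module.End.mul_apply, hι,
      MulOpposite.unop_op]
    rcases List.mem_cons.mp hX with rfl | hX
    · rw [hω, map_zero]
    · refine ih hX ?_
      refine (CliffordAlgebra.contractLeft_comm _ _ _).trans ?_
      rw [contr] at hω
      rw [hω, map_zero, neg_zero]

theorem Bpair_basis_eq_zero {I : Type*} [LinearOrder I] (σ : LinearMap.BilinForm ℝ V)
    (hσ : σ.Nondegenerate) (b : Basis I ℝ (Module.Dual ℝ V)) {s t : Finset I} {i : I}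
    (hi : i ∈ s) (h : ∀ j ∈ t, b j ((σ.toDual hσ).symm (b i)) = 0) :
    Bpair σ hσ (b.ExteriorAlgebra s) (b.ExteriorAlgebra t) = 0 := by
  have hs : sharpMap σ hσ (b.ExteriorAlgebra s) =
      (((s.sort (· ≤ ·)).map fun i => (σ.toDual hσ).symm (b i)).map
        (ExteriorAlgebra.ι ℝ)).prod := by
    rw [ExteriorAlgebra.basis_eq_prod_sort, map_list_prod, List.map_map, List.map_map]
    congr 2
    funext i
    exact ExteriorAlgebra.map_apply_ι _ _
  have ht : b.ExteriorAlgebra t =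
      (((t.sort (· ≤ ·)).map b).map (ExteriorAlgebra.ι ℝ)).prod := by
    rw [ExteriorAlgebra.basis_eq_prod_sort, List.map_map]
    rfl
  rw [Bpair, _root_.dualPairing, hs, ht, insertionOp_prod_ι_eq_zero
    (List.mem_map_of_mem ((Finset.mem_sort _).mpr hi)) (contr_prod_ι_eq_zero ?_), map_zero]
  intro f hf
  obtain ⟨j, hj, rfl⟩ := List.mem_map.mp hf
  exact h j ((Finset.mem_sort _).mp hj)

theorem Finset.sort_map_toLex_disjSum {α β : Type*} [LinearOrder α] [LinearOrder β]
    (s : Finset α) (t : Finset β) :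
    ((s.disjSum t).map toLex.toEmbedding).sort (· ≤ ·) =
      (s.sort (· ≤ ·)).map (fun a => toLex (Sum.inl a)) ++
        (t.sort (· ≤ ·)).map (fun b => toLex (Sum.inr b)) := by
  refine List.SortedLT.eq_of_mem_iff (Finset.sortedLT_sort _) ?_ fun x => ?_
  · rw [List.sortedLT_iff_pairwise, List.pairwise_append, List.pairwise_map, List.pairwise_map]
    refine ⟨?_, ?_, ?_⟩
    · simpa using (Finset.sortedLT_sort s).pairwise
    · simpa using (Finset.sortedLT_sort t).pairwise
    · simp
  · obtain ⟨x | x, rfl⟩ := toLex.surjective x <;> simp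

/-- The basis of the dual space formed by the coordinates `x₁, …, xₙ, y₁, …, yₙ`, in this order. -/
def coordBasis {n : ℕ} (b : Basis (Fin n ⊕ Fin n) ℝ V) :
    Basis (Fin n ⊕ₗ Fin n) ℝ (Module.Dual ℝ V) :=
  b.dualBasis.reindex toLex

omit [FiniteDimensional ℝ V] in
theorem coordBasis_toLex {n : ℕ} (b : Basis (Fin n ⊕ Fin n) ℝ V) (i : Fin n ⊕ Fin n) :
    coordBasis b (toLex i) = b.coord i := by
  simp [coordBasis]

omit [FiniteDimensional ℝ V] in
theorem coordWedge_mul_coordWedge {n : ℕ} (b : Basis (Fin n ⊕ Fin n) ℝ V)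
    (I J : Finset (Fin n)) :
    coordWedge (fun i => b.coord (Sum.inl i)) I * coordWedge (fun i => b.coord (Sum.inr i)) J =
      (coordBasis b).ExteriorAlgebra ((I.disjSum J).map toLex.toEmbedding) := by
  rw [ExteriorAlgebra.basis_eq_prod_sort, Finset.sort_map_toLex_disjSum, List.map_append,
    List.prod_append, List.map_map, List.map_map]
  simp only [coordWedge, Function.comp_def, coordBasis_toLex]

theorem coord_toDual_symm_coord_eq_zero {n : ℕ} {σ : LinearMap.BilinForm ℝ V} (halt : σ.IsAlt)
    (hnd : σ.Nondegenerate) {b : Basis (Fin n ⊕ Fin n) ℝ V}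
    (hb₁ : ∀ i j, σ (b (Sum.inl i)) (b (Sum.inr j)) = if i = j then 1 else 0)
    (hb₂ : ∀ i j, σ (b (Sum.inl i)) (b (Sum.inl j)) = 0)
    (hb₃ : ∀ i j, σ (b (Sum.inr i)) (b (Sum.inr j)) = 0)
    {i j : Fin n ⊕ Fin n} (hij : j ≠ i.swap) :
    b.coord j ((σ.toDual hnd).symm (b.coord i)) = 0 := by
  have hb₄ (i j) : σ (b (Sum.inr i)) (b (Sum.inl j)) = if i = j then -1 else 0 := by
    rw [← halt.neg_eq, hb₁]
    split_ifs <;> simp_all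
  rcases i with i | i
  · have : (σ.toDual hnd).symm (b.coord (Sum.inl i)) = -b (Sum.inr i) := by
      rw [LinearEquiv.symm_apply_eq]
      refine b.ext fun k => ?_
      rw [LinearMap.BilinForm.toDual_def]
      rcases k with k | k <;> simp [hb₃, hb₄, Finsupp.single_apply, eq_comm, apply_ite]
    simpa [this, Finsupp.single_apply] using hij.symm
  · have : (σ.toDual hnd).symm (b.coord (Sum.inr i)) = b (Sum.inl i) := by
      rw [LinearEquiv.symm_apply_eq]
      refine b.ext fun k => ?_
      rw [LinearMap.BilinForm.toDual_def]
      rcases k with k | k <;> simp [hb₁, hb₂, Finsupp.single_apply, eq_comm]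
    simpa [this, Finsupp.single_apply] using hij.symm

/-- In symplectic (Darboux) coordinates, the symplectic Hodge star of a coordinate monomial
`x_I ∧ y_J` is a scalar multiple of a single coordinate monomial `x_{I'} ∧ y_{J'}`. -/
theorem hodgeStar_coord_monomial (V : Type*) [AddCommGroup V] [Module ℝ V]
    [FiniteDimensional ℝ V]
    (σ : LinearMap.BilinForm ℝ V) (halt : σ.IsAlt) (hnd : σ.Nondegenerate)
    (n : ℕ) (hdim : Module.finrank ℝ V = 2 * n)
    (b : Basis (Fin n ⊕ Fin n) ℝ V)
    (hb₁ : ∀ i j, σ (b (Sum.inl i)) (b (Sum.inr j)) = if i = j then 1 else 0)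
    (hb₂ : ∀ i j, σ (b (Sum.inl i)) (b (Sum.inl j)) = 0)
    (hb₃ : ∀ i j, σ (b (Sum.inr i)) (b (Sum.inr j)) = 0)
    (star : ExteriorAlgebra ℝ (Module.Dual ℝ V) → ExteriorAlgebra ℝ (Module.Dual ℝ V))
    (hstar : IsHodgeStar σ hnd n star)
    (I J : Finset (Fin n)) :
    ∃ (c : ℝ) (I' J' : Finset (Fin n)),
      star (coordWedge (fun i => b.coord (Sum.inl i)) I *
            coordWedge (fun i => b.coord (Sum.inr i)) J) =
        c • (coordWedge (fun i => b.coord (Sum.inl i)) I' *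
             coordWedge (fun i => b.coord (Sum.inr i)) J') := by
  have hcard (I J : Finset (Fin n)) :
      ((I.disjSum J).map (toLex (α := Fin n ⊕ Fin n)).toEmbedding).card = I.card + J.card := by
    rw [Finset.card_map, Finset.card_disjSum]
  have hmem (s : Finset (Fin n ⊕ₗ Fin n)) :
      (coordBasis b).ExteriorAlgebra s ∈ ⋀[ℝ]^s.card (Module.Dual ℝ V) := by
    have := ExteriorAlgebra.basis_eq_coe_basis (coordBasis b)
      (Set.powersetCard.ofCard (rfl : s.card = s.card))
    exact this ▸ Subtype.property _
  have hle : I.card + J.card ≤ 2 * n := by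
    have hI := I.card_le_univ
    have hJ := J.card_le_univ
    rw [Fintype.card_fin] at hI hJ
    omega
  set s := (I.disjSum J).map (toLex (α := Fin n ⊕ Fin n)).toEmbedding with hs
  set u := (J.disjSum I).map (toLex (α := Fin n ⊕ Fin n)).toEmbedding with hu
  have hus : u.card = s.card := by rw [hu, hs, hcard, hcard, add_comm]
  rw [coordWedge_mul_coordWedge, ← hs]
  obtain ⟨hdeg, hmul⟩ := hstar s.card (by rw [hs, hcard]; exact hle) _ (hmem s)
  obtain ⟨c, hc⟩ := ExteriorAlgebra.eq_smul_basis_compl_of_basis_mul_eq_zero (coordBasis b) hdeg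
    (u := u) (by
      rw [hus, hs, hcard, Fintype.card_lex, Fintype.card_sum, Fintype.card_fin]
      omega) (by
      intro t ht htu
      obtain ⟨i, hit, hiu⟩ : ∃ i ∈ t, i ∉ u := by
        by_contra! hsub
        exact htu (Finset.eq_of_subset_of_card_le hsub ht.ge)
      rw [hmul _ (hus ▸ ht ▸ hmem t), Bpair_basis_eq_zero σ hnd (coordBasis b) hit, zero_smul]
      intro j hj
      rw [← toLex_ofLex i, ← toLex_ofLex j, coordBasis_toLex, coordBasis_toLex]
      refine coord_toDual_symm_coord_eq_zero halt hnd hb₁ hb₂ hb₃ fun hji => hiu ?_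
      rw [← toLex_ofLex j, hji] at hj
      rw [← toLex_ofLex i]
      generalize ofLex i = k at hj
      cases k <;> simpa [hs, hu] using hj)
  refine ⟨c, (uᶜ.map ofLex.toEmbedding).toLeft, (uᶜ.map ofLex.toEmbedding).toRight, ?_⟩
  rw [hc, coordWedge_mul_coordWedge, Finset.toLeft_disjSum_toRight, Finset.map_map]
  congr 2
  ext x
  simp

end
end

section
/- Let (V, σ) be a symplectic vector space with dim V = 2n and let 0 ≤ k ≤ n. Then the Lefschetz map L^{n−k} : ⋀^k V* → ⋀^{2n−k} V*, α ↦ σ^{n−k} ∧ α, is a linear isomorphism. -/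
open ExteriorAlgebra Module

set_option synthInstance.maxHeartbeats 1000000
set_option maxHeartbeats 1000000

noncomputable section

variable {V : Type*} [AddCommGroup V] [Module ℝ V] [FiniteDimensional ℝ V]

set_option linter.unusedSectionVars false

/-- The interior product `ι_v` on the exterior algebra of the dual space. -/
def interiorProduct : V →ₗ[ℝ] Module.End ℝ (ExteriorAlgebra ℝ (Module.Dual ℝ V)) :=
  CliffordAlgebra.contractLeft ∘ₗ Module.Dual.eval ℝ V

lemma interiorProduct_ι_mul (v : V) (f : Module.Dual ℝ V)
    (a : ExteriorAlgebra ℝ (Module.Dual ℝ V)) :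
    interiorProduct v (ι ℝ f * a) = f v • a - ι ℝ f * interiorProduct v a :=
  CliffordAlgebra.contractLeft_ι_mul _ _ _

lemma interiorProduct_eq_zero_of_mem (v : V) {a : ExteriorAlgebra ℝ (Module.Dual ℝ V)}
    (ha : a ∈ ⋀[ℝ]^0 (Module.Dual ℝ V)) : interiorProduct v a = 0 := by
  rw [exteriorPower, pow_zero, Submodule.mem_one] at ha
  obtain ⟨r, rfl⟩ := ha
  exact CliffordAlgebra.contractLeft_algebraMap _ (Module.Dual.eval ℝ V v) r

lemma exteriorPower_succ_induction {k : ℕ} {P : ExteriorAlgebra ℝ (Module.Dual ℝ V) → Prop}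
    (hmul : ∀ f, ∀ a ∈ ⋀[ℝ]^k (Module.Dual ℝ V), P (ι ℝ f * a))
    (hadd : ∀ a b, P a → P b → P (a + b))
    {a : ExteriorAlgebra ℝ (Module.Dual ℝ V)} (ha : a ∈ ⋀[ℝ]^(k + 1) (Module.Dual ℝ V)) :
    P a := by
  rw [exteriorPower, pow_succ'] at ha
  refine Submodule.mul_induction_on ha ?_ hadd
  rintro _ ⟨f, rfl⟩ b hb
  exact hmul f b hb

lemma ι_mul_mem_exteriorPower (f : Module.Dual ℝ V) {k : ℕ}
    {a : ExteriorAlgebra ℝ (Module.Dual ℝ V)} (ha : a ∈ ⋀[ℝ]^k (Module.Dual ℝ V)) :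
    ι ℝ f * a ∈ ⋀[ℝ]^(k + 1) (Module.Dual ℝ V) := by
  rw [exteriorPower, pow_succ']
  exact Submodule.mul_mem_mul ⟨f, rfl⟩ ha

lemma interiorProduct_mem (v : V) (k : ℕ) {a : ExteriorAlgebra ℝ (Module.Dual ℝ V)}
    (ha : a ∈ ⋀[ℝ]^(k + 1) (Module.Dual ℝ V)) :
    interiorProduct v a ∈ ⋀[ℝ]^k (Module.Dual ℝ V) := by
  induction k generalizing a with
  | zero =>
    refine exteriorPower_succ_induction (P := fun x => interiorProduct v x ∈ ⋀[ℝ]^0 _)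
      (fun f b hb => ?_) (fun b c hb hc => ?_) ha
    · rw [interiorProduct_ι_mul, interiorProduct_eq_zero_of_mem v hb, mul_zero, sub_zero]
      exact Submodule.smul_mem _ _ hb
    · rw [map_add]
      exact add_mem hb hc
  | succ k ih =>
    refine exteriorPower_succ_induction (P := fun x => interiorProduct v x ∈ ⋀[ℝ]^(k + 1) _)
      (fun f b hb => ?_) (fun b c hb hc => ?_) ha
    · rw [interiorProduct_ι_mul]
      exact sub_mem (Submodule.smul_mem _ _ hb) (ι_mul_mem_exteriorPower f (ih hb))
    · rw [map_add]
      exact add_mem hb hc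

lemma sum_apply_smul_coord {I : Type*} [Fintype I] (b : Basis I ℝ V) (f : Module.Dual ℝ V) :
    ∑ i, f (b i) • b.coord i = f := by
  classical
  refine b.ext fun j => ?_
  simp

/-- Euler's identity: `∑ eⁱ ∧ ι_{eᵢ}` acts on `⋀ᵏ V*` as multiplication by `k`. -/
lemma sum_ι_coord_mul_interiorProduct {I : Type*} [Fintype I] (b : Basis I ℝ V) (k : ℕ)
    {a : ExteriorAlgebra ℝ (Module.Dual ℝ V)} (ha : a ∈ ⋀[ℝ]^k (Module.Dual ℝ V)) :
    ∑ i, ι ℝ (b.coord i) * interiorProduct (b i) a = (k : ℝ) • a := by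
  induction k generalizing a with
  | zero => simp [interiorProduct_eq_zero_of_mem _ ha]
  | succ k ih =>
    refine exteriorPower_succ_induction
      (P := fun x => ∑ i, ι ℝ (b.coord i) * interiorProduct (b i) x = ((k + 1 : ℕ) : ℝ) • x)
      (fun f c hc => ?_) (fun c d hc hd => ?_) ha
    · have anti (i : I) : ι ℝ (b.coord i) * (ι ℝ f * interiorProduct (b i) c) =
          -(ι ℝ f * (ι ℝ (b.coord i) * interiorProduct (b i) c)) := by
        rw [← mul_assoc, ← mul_assoc, ← neg_mul,
          eq_neg_of_add_eq_zero_left (ExteriorAlgebra.ι_add_mul_swap (b.coord i) f)]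
      have hf : ∑ i, f (b i) • ι ℝ (b.coord i) = ι ℝ f := by
        conv_rhs => rw [← sum_apply_smul_coord b f, map_sum]
        simp only [map_smul]
      simp only [interiorProduct_ι_mul, mul_sub, anti, sub_neg_eq_add, Finset.sum_add_distrib,
        mul_smul_comm, ← Finset.mul_sum, ih hc]
      simp only [← smul_mul_assoc, ← Finset.sum_mul, hf]
      push_cast
      rw [add_smul, one_smul, add_comm, add_mul]
    · simp only [map_add, mul_add, Finset.sum_add_distrib, smul_add, hc, hd]

lemma sigmaForm_mem (σ : LinearMap.BilinForm ℝ V) :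
    sigmaForm σ ∈ ⋀[ℝ]^2 (Module.Dual ℝ V) := by
  refine Submodule.smul_mem _ _ (sum_mem fun i _ => sum_mem fun j _ => Submodule.smul_mem _ _ ?_)
  rw [exteriorPower, pow_two]
  exact Submodule.mul_mem_mul ⟨_, rfl⟩ ⟨_, rfl⟩

lemma sigmaForm_pow_mul_mem (σ : LinearMap.BilinForm ℝ V) (r : ℕ) {k m : ℕ}
    (hm : 2 * r + k = m) {a : ExteriorAlgebra ℝ (Module.Dual ℝ V)}
    (ha : a ∈ ⋀[ℝ]^k (Module.Dual ℝ V)) :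
    sigmaForm σ ^ r * a ∈ ⋀[ℝ]^m (Module.Dual ℝ V) := by
  rw [← hm, exteriorPower, pow_add, pow_mul]
  exact Submodule.mul_mem_mul (Submodule.pow_mem_pow _ (sigmaForm_mem σ) r) ha

lemma interiorProduct_sigmaForm_mul (σ : LinearMap.BilinForm ℝ V) (halt : σ.IsAlt) (v : V)
    (a : ExteriorAlgebra ℝ (Module.Dual ℝ V)) :
    interiorProduct v (sigmaForm σ * a) =
      ι ℝ (σ v) * a + sigmaForm σ * interiorProduct v a := by
  set b := Module.finBasis ℝ V with hb
  have h1 : ∑ i, ∑ j, σ (b i) (b j) • (b.coord i v • ι ℝ (b.coord j)) = ι ℝ (σ v) := by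
    have hrow (i) : ∑ j, σ (b i) (b j) • (b.coord i v • ι ℝ (b.coord j)) =
        b.coord i v • ι ℝ (σ (b i)) := by
      conv_rhs => rw [← sum_apply_smul_coord b (σ (b i)), map_sum, Finset.smul_sum]
      refine Finset.sum_congr rfl fun j _ => ?_
      rw [map_smul, smul_comm]
    rw [Finset.sum_congr rfl fun i _ => hrow i]
    simp only [← map_smul, ← map_sum]
    simp only [Basis.coord_apply, b.sum_repr]
  have h2 : ∑ i, ∑ j, σ (b i) (b j) • (b.coord j v • ι ℝ (b.coord i)) = -ι ℝ (σ v) := by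
    rw [Finset.sum_comm, ← h1]
    simp only [← Finset.sum_neg_distrib]
    refine Finset.sum_congr rfl fun i _ => Finset.sum_congr rfl fun j _ => ?_
    rw [← halt.neg_eq (b i) (b j), neg_smul]
  have key (i j) : interiorProduct v (ι ℝ (b.coord i) * ι ℝ (b.coord j) * a) =
      (b.coord i v • ι ℝ (b.coord j)) * a - (b.coord j v • ι ℝ (b.coord i)) * a
        + ι ℝ (b.coord i) * ι ℝ (b.coord j) * interiorProduct v a := by
    rw [mul_assoc, interiorProduct_ι_mul, interiorProduct_ι_mul, mul_sub, smul_mul_assoc,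
      mul_smul_comm, smul_mul_assoc, mul_assoc]
    abel
  have h3 : ι ℝ (σ v) = (2 : ℝ)⁻¹ • (ι ℝ (σ v) - -ι ℝ (σ v)) := by
    rw [sub_neg_eq_add, ← two_smul ℝ (ι ℝ (σ v)), smul_smul]
    norm_num
  rw [h3]
  nth_rw 1 [← h1]
  rw [← h2]
  simp only [sigmaForm, ← hb, smul_mul_assoc, Finset.sum_mul, map_smul, map_sum, key, smul_add,
    smul_sub, Finset.sum_add_distrib, Finset.sum_sub_distrib, sub_mul]

/-- Twice the dual Lefschetz operator: contraction with the bivector inverse to `σ`. -/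
def dualLefschetz (σ : LinearMap.BilinForm ℝ V) (hnd : σ.Nondegenerate) :
    Module.End ℝ (ExteriorAlgebra ℝ (Module.Dual ℝ V)) :=
  ∑ i, interiorProduct (Module.finBasis ℝ V i) *
    interiorProduct ((LinearMap.BilinForm.toDual σ hnd).symm ((Module.finBasis ℝ V).coord i))

lemma dualLefschetz_apply (σ : LinearMap.BilinForm ℝ V) (hnd : σ.Nondegenerate)
    (a : ExteriorAlgebra ℝ (Module.Dual ℝ V)) :
    dualLefschetz σ hnd a = ∑ i, interiorProduct (Module.finBasis ℝ V i) (interiorProduct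
      ((LinearMap.BilinForm.toDual σ hnd).symm ((Module.finBasis ℝ V).coord i)) a) := by
  simp [dualLefschetz, LinearMap.sum_apply]

lemma dualLefschetz_mem (σ : LinearMap.BilinForm ℝ V) (hnd : σ.Nondegenerate) {k : ℕ}
    {a : ExteriorAlgebra ℝ (Module.Dual ℝ V)} (ha : a ∈ ⋀[ℝ]^(k + 2) (Module.Dual ℝ V)) :
    dualLefschetz σ hnd a ∈ ⋀[ℝ]^k (Module.Dual ℝ V) := by
  rw [dualLefschetz_apply]
  exact sum_mem fun i _ => interiorProduct_mem _ _ (interiorProduct_mem _ _ ha)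

lemma dualLefschetz_eq_zero (σ : LinearMap.BilinForm ℝ V) (hnd : σ.Nondegenerate) {k : ℕ}
    (hk : k < 2) {a : ExteriorAlgebra ℝ (Module.Dual ℝ V)}
    (ha : a ∈ ⋀[ℝ]^k (Module.Dual ℝ V)) : dualLefschetz σ hnd a = 0 := by
  rw [dualLefschetz_apply]
  refine Finset.sum_eq_zero fun i _ => ?_
  interval_cases k
  · rw [interiorProduct_eq_zero_of_mem _ ha, map_zero]
  · exact interiorProduct_eq_zero_of_mem _ (interiorProduct_mem _ _ ha)

lemma sum_ι_mul_interiorProduct_toDual_symm (σ : LinearMap.BilinForm ℝ V) (halt : σ.IsAlt)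
    (hnd : σ.Nondegenerate) {I : Type*} [Fintype I] (b : Basis I ℝ V)
    (a : ExteriorAlgebra ℝ (Module.Dual ℝ V)) :
    ∑ i, ι ℝ (σ (b i)) * interiorProduct
        ((LinearMap.BilinForm.toDual σ hnd).symm (b.coord i)) a =
      -∑ i, ι ℝ (b.coord i) * interiorProduct (b i) a := by
  set f : I → V := fun i => (LinearMap.BilinForm.toDual σ hnd).symm (b.coord i) with hf
  have hfσ (i : I) (v : V) : σ (f i) v = b.coord i v :=
    LinearMap.BilinForm.apply_toDual_symm_apply _ _
  have hanti (i j : I) : b.coord j (f i) = -b.coord i (f j) := by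
    rw [← hfσ, ← hfσ, halt.neg_eq]
  have hsum (j : I) : ∑ i, b.coord i (f j) • σ (b i) = b.coord j := by
    simp only [← map_smul, ← map_sum]
    simp only [Basis.coord_apply, b.sum_repr]
    exact LinearMap.ext fun v => hfσ j v
  calc ∑ i, ι ℝ (σ (b i)) * interiorProduct (f i) a
      = ∑ i, ∑ j, b.coord j (f i) • (ι ℝ (σ (b i)) * interiorProduct (b j) a) := by
        refine Finset.sum_congr rfl fun i _ => ?_
        conv_lhs => rw [← b.sum_repr (f i), map_sum, LinearMap.sum_apply, Finset.mul_sum]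
        simp only [map_smul, LinearMap.smul_apply, mul_smul_comm, Basis.coord_apply]
    _ = ∑ j, -(ι ℝ (∑ i, b.coord i (f j) • σ (b i)) * interiorProduct (b j) a) := by
        rw [Finset.sum_comm]
        refine Finset.sum_congr rfl fun j _ => ?_
        simp only [map_sum, map_smul, Finset.sum_mul, smul_mul_assoc, ← Finset.sum_neg_distrib]
        refine Finset.sum_congr rfl fun i _ => ?_
        rw [hanti, neg_smul]
    _ = _ := by simp only [hsum, Finset.sum_neg_distrib]

lemma dualLefschetz_sigmaForm_mul (σ : LinearMap.BilinForm ℝ V) (halt : σ.IsAlt)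
    (hnd : σ.Nondegenerate) {k : ℕ} {a : ExteriorAlgebra ℝ (Module.Dual ℝ V)}
    (ha : a ∈ ⋀[ℝ]^k (Module.Dual ℝ V)) :
    dualLefschetz σ hnd (sigmaForm σ * a) =
      sigmaForm σ * dualLefschetz σ hnd a + ((Module.finrank ℝ V : ℝ) - 2 * k) • a := by
  have hσ (i) : σ ((LinearMap.BilinForm.toDual σ hnd).symm ((Module.finBasis ℝ V).coord i)) =
      (Module.finBasis ℝ V).coord i :=
    LinearMap.ext fun v => LinearMap.BilinForm.apply_toDual_symm_apply _ _
  have hone (i) : (Module.finBasis ℝ V).coord i (Module.finBasis ℝ V i) = 1 := by simp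
  simp only [dualLefschetz_apply, interiorProduct_sigmaForm_mul σ halt, map_add, hσ,
    interiorProduct_ι_mul, hone, one_smul, Finset.sum_add_distrib, Finset.sum_sub_distrib,
    sum_ι_coord_mul_interiorProduct _ k ha, sum_ι_mul_interiorProduct_toDual_symm σ halt hnd,
    Finset.mul_sum, Finset.sum_const, Finset.card_univ, Fintype.card_fin]
  module

lemma dualLefschetz_sigmaForm_pow_mul (σ : LinearMap.BilinForm ℝ V) (halt : σ.IsAlt)
    (hnd : σ.Nondegenerate) (r : ℕ) {k : ℕ} {a : ExteriorAlgebra ℝ (Module.Dual ℝ V)}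
    (ha : a ∈ ⋀[ℝ]^k (Module.Dual ℝ V)) :
    dualLefschetz σ hnd (sigmaForm σ ^ (r + 1) * a) =
      sigmaForm σ ^ (r + 1) * dualLefschetz σ hnd a +
        ((r + 1) * ((Module.finrank ℝ V : ℝ) - 2 * k - 2 * r)) • (sigmaForm σ ^ r * a) := by
  induction r with
  | zero => simpa using dualLefschetz_sigmaForm_mul σ halt hnd ha
  | succ r ih =>
    rw [pow_succ' _ (r + 1), mul_assoc, dualLefschetz_sigmaForm_mul σ halt hnd
      (sigmaForm_pow_mul_mem σ (r + 1) rfl ha), ih, mul_add, mul_smul_comm, ← mul_assoc,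
      ← mul_assoc, ← pow_succ', ← pow_succ']
    push_cast
    module

lemma eq_zero_of_sigmaForm_pow_mul_eq_zero (σ : LinearMap.BilinForm ℝ V) (halt : σ.IsAlt)
    (hnd : σ.Nondegenerate) (k r : ℕ) (hr : 2 * (k + r) ≤ Module.finrank ℝ V)
    {a : ExteriorAlgebra ℝ (Module.Dual ℝ V)} (ha : a ∈ ⋀[ℝ]^k (Module.Dual ℝ V))
    (h : sigmaForm σ ^ r * a = 0) : a = 0 := by
  induction k using Nat.strong_induction_on generalizing r a with
  | _ k ihk =>
  induction r generalizing a with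
  | zero => simpa using h
  | succ r ihr =>
    set c : ℝ := (r + 1) * ((Module.finrank ℝ V : ℝ) - 2 * k - 2 * r) with hc
    have hc0 : c ≠ 0 := by
      have : (2 * (k + (r + 1)) : ℝ) ≤ Module.finrank ℝ V := by exact_mod_cast hr
      have : (0 : ℝ) < c := mul_pos (by positivity) (by linarith)
      exact this.ne'
    have hcomm := dualLefschetz_sigmaForm_pow_mul σ halt hnd r ha
    rw [h, map_zero, ← hc] at hcomm
    suffices hΛ : dualLefschetz σ hnd a = 0 by
      rw [hΛ, mul_zero, zero_add] at hcomm
      exact ihr (by omega) ha ((smul_eq_zero.mp hcomm.symm).resolve_left hc0)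
    rcases lt_or_ge k 2 with hk | hk
    · exact dualLefschetz_eq_zero σ hnd hk ha
    obtain ⟨l, rfl⟩ := Nat.exists_eq_add_of_le' hk
    have hΛa := dualLefschetz_mem σ hnd ha
    have hLΛ : sigmaForm σ * dualLefschetz σ hnd a + c • a = 0 := by
      refine ihr (by omega) (add_mem ?_ (Submodule.smul_mem _ _ ha)) ?_
      · simpa using sigmaForm_pow_mul_mem σ 1 (m := l + 2) (by omega) hΛa
      · rw [mul_add, ← mul_assoc, ← pow_succ, mul_smul_comm, ← hcomm]
    refine ihk l (by omega) (r + 2) (by omega) hΛa ?_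
    rw [pow_succ, mul_assoc, eq_neg_of_add_eq_zero_left hLΛ, mul_neg, mul_smul_comm, h,
      smul_zero, neg_zero]

/-- For `0 ≤ k ≤ n`, the Lefschetz map `L^(n-k) : ⋀^k V* → ⋀^(2n-k) V*`, `α ↦ σ^(n-k) ∧ α`,
is a linear isomorphism. -/
theorem lefschetz_map_bijective (V : Type*) [AddCommGroup V] [Module ℝ V]
    [FiniteDimensional ℝ V]
    (σ : LinearMap.BilinForm ℝ V) (halt : σ.IsAlt) (hnd : σ.Nondegenerate)
    (n : ℕ) (hdim : Module.finrank ℝ V = 2 * n) (k : ℕ) (hk : k ≤ n) :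
    (∀ α ∈ ⋀[ℝ]^k (Module.Dual ℝ V),
        (sigmaForm σ) ^ (n - k) * α ∈ ⋀[ℝ]^(2 * n - k) (Module.Dual ℝ V)) ∧
    Set.BijOn (fun α => (sigmaForm σ) ^ (n - k) * α)
      (⋀[ℝ]^k (Module.Dual ℝ V) : Set (ExteriorAlgebra ℝ (Module.Dual ℝ V)))
      (⋀[ℝ]^(2 * n - k) (Module.Dual ℝ V) : Set (ExteriorAlgebra ℝ (Module.Dual ℝ V))) := by
  have hmem : ∀ α ∈ ⋀[ℝ]^k (Module.Dual ℝ V),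
      (sigmaForm σ) ^ (n - k) * α ∈ ⋀[ℝ]^(2 * n - k) (Module.Dual ℝ V) := fun α hα =>
    sigmaForm_pow_mul_mem σ (n - k) (by omega) hα
  let L : ⋀[ℝ]^k (Module.Dual ℝ V) →ₗ[ℝ] ⋀[ℝ]^(2 * n - k) (Module.Dual ℝ V) :=
    (LinearMap.mulLeft ℝ (sigmaForm σ ^ (n - k))).restrict hmem
  have hinj : Function.Injective L := by
    rw [injective_iff_map_eq_zero]
    intro a ha
    exact Subtype.ext (eq_zero_of_sigmaForm_pow_mul_eq_zero σ halt hnd k (n - k) (by omega) a.2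
      (congrArg Subtype.val ha))
  have hrank : Module.finrank ℝ (⋀[ℝ]^k (Module.Dual ℝ V)) =
      Module.finrank ℝ (⋀[ℝ]^(2 * n - k) (Module.Dual ℝ V)) := by
    rw [exteriorPower.finrank_eq, exteriorPower.finrank_eq, Subspace.dual_finrank_eq, hdim,
      Nat.choose_symm (by omega)]
  have hsurj : Function.Surjective L :=
    (LinearMap.injective_iff_surjective_of_finrank_eq_finrank hrank).mp hinj
  refine ⟨hmem, hmem, fun a ha b hb hab => ?_, fun c hc => ?_⟩
  · exact congrArg Subtype.val (@hinj ⟨a, ha⟩ ⟨b, hb⟩ (Subtype.ext hab))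
  · obtain ⟨a, ha⟩ := hsurj ⟨c, hc⟩
    exact ⟨a, a.2, congrArg Subtype.val ha⟩

end
end

section
/- Let W be an sl(2)-module of finite H-type. Then for every integer k ≥ 0, the operator L maps W_k into W_{k−2}, and the k-fold iterate L^k restricts to a linear isomorphism from W_k onto W_{−k}. -/
noncomputable section

variable {W : Type*} [AddCommGroup W] [Module ℝ W]

/-- The weight space (eigenspace) `W_λ = ker (H - λ·id)` of the operator `H`. -/
def weightSpace (H : Module.End ℝ W) (lam : ℤ) : Submodule ℝ W :=
  LinearMap.ker (H - (lam : ℝ) • (1 : Module.End ℝ W))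

theorem mem_weightSpace_iff {H : Module.End ℝ W} {l : ℤ} {w : W} :
    w ∈ weightSpace H l ↔ H w = (l : ℝ) • w := by
  simp [weightSpace, sub_eq_zero]

theorem weightSpace_neg (H : Module.End ℝ W) (l : ℤ) :
    weightSpace (-H) l = weightSpace H (-l) := by
  ext w
  simp [mem_weightSpace_iff, neg_eq_iff_eq_neg]

theorem lower_mem_weightSpace {F H : Module.End ℝ W}
    (hHF : ∀ w, H (F w) = F (H w) - (2 : ℝ) • F w) {l : ℤ} {w : W}
    (hw : w ∈ weightSpace H l) : F w ∈ weightSpace H (l - 2) := by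
  rw [mem_weightSpace_iff] at *
  rw [hHF, hw, map_smul]
  push_cast
  module

theorem raise_mem_weightSpace {E H : Module.End ℝ W}
    (hHE : ∀ w, H (E w) = E (H w) + (2 : ℝ) • E w) {l : ℤ} {w : W}
    (hw : w ∈ weightSpace H l) : E w ∈ weightSpace H (l + 2) := by
  rw [mem_weightSpace_iff] at *
  rw [hHE, hw, map_smul]
  push_cast
  module

theorem pow_lower_mem_weightSpace {F H : Module.End ℝ W}
    (hHF : ∀ w, H (F w) = F (H w) - (2 : ℝ) • F w) (j : ℕ) {l : ℤ} {w : W}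
    (hw : w ∈ weightSpace H l) : (F ^ j) w ∈ weightSpace H (l - 2 * j) := by
  induction j with
  | zero => simpa using hw
  | succ j ih =>
    have := lower_mem_weightSpace hHF ih
    rw [pow_succ', Module.End.mul_apply]
    rwa [show l - 2 * ((j + 1 : ℕ) : ℤ) = l - 2 * j - 2 by push_cast; ring]

/-- On a weight space of nonnegative weight, `FE + a` is bijective for all `a > 0`, provided
only finitely many weights occur. -/
theorem bijOn_lower_raise_add_smul {E F H : Module.End ℝ W}
    (hEF : ∀ w, E (F w) = F (E w) + H w)
    (hHE : ∀ w, H (E w) = E (H w) + (2 : ℝ) • E w)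
    (hHF : ∀ w, H (F w) = F (H w) - (2 : ℝ) • F w)
    (hfin : {l : ℤ | weightSpace H l ≠ ⊥}.Finite) {l : ℤ} (hl : 0 ≤ l) {a : ℝ} (ha : 0 < a) :
    Set.BijOn (fun w => F (E w) + a • w) (weightSpace H l) (weightSpace H l) := by
  obtain ⟨N, hN⟩ := hfin.bddAbove
  obtain ⟨n, hn⟩ : ∃ n : ℕ, N < l + 2 * n := ⟨(N - l).toNat + 1, by omega⟩
  induction n generalizing l a with
  | zero =>
    have hbot : weightSpace H l = ⊥ := by
      by_contra h
      have := hN h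
      omega
    simp [hbot]
  | succ n ih =>
    have hl' : (0 : ℝ) ≤ l := by exact_mod_cast hl
    have hup := ih (l := l + 2) (by omega) (a := l + 2 + a) (by positivity)
      (by push_cast at hn; omega)
    have hup_eq : ∀ u ∈ weightSpace H (l + 2),
        F (E u) + ((l : ℝ) + 2 + a) • u = E (F u) + a • u := fun u hu => by
      rw [hEF, mem_weightSpace_iff.1 hu]
      push_cast
      module
    refine ⟨fun w hw => ?_, fun v hv w hw hvw => ?_, fun v hv => ?_⟩
    · have := lower_mem_weightSpace hHF (raise_mem_weightSpace hHE hw)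
      rw [add_sub_cancel_right] at this
      exact add_mem this (Submodule.smul_mem _ _ hw)
    · have hE : E v = E w := by
        have hv' := raise_mem_weightSpace hHE hv
        have hw' := raise_mem_weightSpace hHE hw
        refine hup.injOn hv' hw' ?_
        simp only [hup_eq _ hv', hup_eq _ hw']
        simpa using congrArg E hvw
      simp only [hE, add_right_inj] at hvw
      exact smul_right_injective W ha.ne' hvw
    · obtain ⟨u, hu, huv⟩ := hup.surjOn (raise_mem_weightSpace hHE hv)
      simp only [hup_eq u hu] at huv
      refine ⟨a⁻¹ • (v - F u), Submodule.smul_mem _ _ (sub_mem hv ?_), ?_⟩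
      · simpa using lower_mem_weightSpace hHF hu
      · have hE : E (v - F u) = a • u := by rw [map_sub, ← huv]; abel
        simp only [map_smul, hE, smul_smul, inv_mul_cancel₀ ha.ne', mul_inv_cancel₀ ha.ne',
          one_smul]
        abel

theorem raise_pow_succ_lower {E F H : Module.End ℝ W}
    (hEF : ∀ w, E (F w) = F (E w) + H w)
    (hHF : ∀ w, H (F w) = F (H w) - (2 : ℝ) • F w) (j : ℕ) {l : ℤ} {w : W}
    (hw : w ∈ weightSpace H l) :
    E ((F ^ (j + 1)) w) = (F ^ j) (F (E w) + (((j : ℝ) + 1) * (l - j)) • w) := by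
  induction j generalizing l w with
  | zero => simp [hEF, mem_weightSpace_iff.1 hw]
  | succ j ih =>
    rw [pow_succ, Module.End.mul_apply, ih (lower_mem_weightSpace hHF hw), pow_succ,
      Module.End.mul_apply, hEF, mem_weightSpace_iff.1 hw]
    congr 1
    simp only [map_add, map_smul]
    push_cast
    module

theorem bijOn_raise_pow_lower_pow {E F H : Module.End ℝ W}
    (hEF : ∀ w, E (F w) = F (E w) + H w)
    (hHE : ∀ w, H (E w) = E (H w) + (2 : ℝ) • E w)
    (hHF : ∀ w, H (F w) = F (H w) - (2 : ℝ) • F w)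
    (hfin : {l : ℤ | weightSpace H l ≠ ⊥}.Finite) {k : ℕ} (j : ℕ) (hj : j ≤ k) :
    Set.BijOn (fun w => (E ^ j) ((F ^ j) w)) (weightSpace H k) (weightSpace H k) := by
  induction j with
  | zero => exact Set.bijOn_id _
  | succ j ih =>
    have hpos : 0 < ((j : ℝ) + 1) * (((k : ℤ) : ℝ) - j) := by
      have : (j : ℝ) < k := by exact_mod_cast hj
      have : (0 : ℝ) < ((k : ℤ) : ℝ) - j := by push_cast; linarith
      positivity
    refine ((ih (by omega)).comp (bijOn_lower_raise_add_smul hEF hHE hHF hfin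
      (Int.natCast_nonneg k) hpos)).congr fun w hw => ?_
    simp only [Function.comp_apply]
    rw [← raise_pow_succ_lower hEF hHF j hw, pow_succ E, Module.End.mul_apply]

/-- For an `sl(2)`-module of finite `H`-type, `L` maps `W_k` into `W_{k-2}`, and `L^k`
restricts to a linear isomorphism `W_k ≅ W_{-k}` for every integer `k ≥ 0`. -/
theorem sl2_lefschetz_iso {W : Type*} [AddCommGroup W] [Module ℝ W]
    (L Lam H : Module.End ℝ W)
    (hrel₁ : Lam * L - L * Lam = H)
    (hrel₂ : H * Lam - Lam * H = (2 : ℝ) • Lam)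
    (hrel₃ : H * L - L * H = -((2 : ℝ) • L))
    (hinternal : DirectSum.IsInternal fun lam : ℤ => weightSpace H lam)
    (hfin : {lam : ℤ | weightSpace H lam ≠ ⊥}.Finite)
    (k : ℕ) :
    (∀ w ∈ weightSpace H (k : ℤ), L w ∈ weightSpace H ((k : ℤ) - 2)) ∧
    Set.BijOn (⇑(L ^ k)) (weightSpace H (k : ℤ) : Set W)
      (weightSpace H (-(k : ℤ)) : Set W) := by
  have h₁ : ∀ w, Lam (L w) = L (Lam w) + H w := fun w => by
    rw [← hrel₁]; simp
  have h₂ : ∀ w, H (Lam w) = Lam (H w) + (2 : ℝ) • Lam w := fun w => by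
    have := LinearMap.congr_fun hrel₂ w
    simp only [LinearMap.sub_apply, Module.End.mul_apply, LinearMap.smul_apply] at this
    rw [← this]; abel
  have h₃ : ∀ w, H (L w) = L (H w) - (2 : ℝ) • L w := fun w => by
    have := LinearMap.congr_fun hrel₃ w
    simp only [LinearMap.sub_apply, Module.End.mul_apply, LinearMap.smul_apply,
      LinearMap.neg_apply] at this
    rw [sub_eq_add_neg, ← this]; abel
  have hF : ∀ l : ℤ, ∀ w ∈ weightSpace H l, L w ∈ weightSpace H (l - 2) :=
    fun _ _ => lower_mem_weightSpace h₃
  have hE : ∀ l : ℤ, ∀ w ∈ weightSpace H l, Lam w ∈ weightSpace H (l + 2) :=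
    fun _ _ => raise_mem_weightSpace h₂
  have hneg : ∀ l : ℤ, weightSpace (-H) l = weightSpace H (-l) := weightSpace_neg H
  have hfin' : {l : ℤ | weightSpace (-H) l ≠ ⊥}.Finite := by
    have := hfin.preimage (neg_injective (G := ℤ)).injOn
    simp only [hneg]
    exact this
  have hpos := bijOn_raise_pow_lower_pow h₁ h₂ h₃ hfin k le_rfl
  have hmin := bijOn_raise_pow_lower_pow (E := L) (F := Lam) (H := -H)
    (fun w => by simp [h₁ w]) (fun w => by simp [h₃ w]; abel)
    (fun w => by simp [h₂ w]; abel) hfin' k le_rfl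
  rw [hneg] at hmin
  refine ⟨hF k, fun w hw => ?_, fun v hv w hw hvw => ?_, fun v hv => ?_⟩
  · have := pow_lower_mem_weightSpace h₃ k hw
    rwa [show (k : ℤ) - 2 * k = -k by ring] at this
  · exact hpos.injOn hv hw (congrArg (⇑(Lam ^ k)) hvw)
  · obtain ⟨u, hu, rfl⟩ := hmin.surjOn hv
    refine ⟨(Lam ^ k) u, ?_, rfl⟩
    rw [← hneg] at hu
    have := pow_lower_mem_weightSpace (F := Lam) (H := -H)
      (fun w => by simp [h₂ w]; abel) k hu
    rwa [hneg, show -((k : ℤ) - 2 * k) = k by ring] at this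

end
end
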